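/- arXiv:2410.07829 — 5 statements merged into one kernel-verified Lean document; each statement's English description precedes it below -/
import Mathlib

section
/- Let f : ℝ → ℝ be defined by f(x) = 0 if x ≤ −3; f(x) = x + 3 if −3 < x ≤ −2; f(x) = −x − 1 if −2 < x < −1; and f(x) = 0 if x ≥ −1. For every positive natural number b, there exist finite simple graphs G_1, ..., G_b such that for every bit string x = (x_1, ..., x_b) ∈ {0,1}^b, setting γ_x = Σ_{k=1}^{b} x_k · 2^{k−1}, it holds for every j ∈ {1, ..., b} that Σ_{v ∈ V(G_j)} f(γ_x − deg_{G_j}(v)) = x_j. -/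
/-- The piecewise linear activation function:
f(x) = 0 if x ≤ −3; f(x) = x + 3 if −3 < x ≤ −2; f(x) = −x − 1 if −2 < x < −1;
f(x) = 0 if x ≥ −1. -/
noncomputable def pwlActivation (x : ℝ) : ℝ :=
  if x ≤ -3 then 0
  else if x ≤ -2 then x + 3
  else if x < -1 then -x - 1
  else 0

theorem pwlActivation_natCast_sub_natCast (g d : ℕ) :
    pwlActivation ((g : ℝ) - d) = if d = g + 2 then 1 else 0 := by
  unfold pwlActivation
  obtain h | rfl | h : d ≤ g + 1 ∨ d = g + 2 ∨ g + 3 ≤ d := by omega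
  · have h' : (d : ℝ) ≤ g + 1 := by exact_mod_cast h
    rw [if_neg (by linarith), if_neg (by linarith), if_neg (by linarith), if_neg (by omega)]
  · push_cast
    rw [if_neg (by linarith), if_pos (by linarith), if_pos rfl]
    ring
  · have h' : (g : ℝ) + 3 ≤ d := by exact_mod_cast h
    rw [if_pos (by linarith), if_neg (by omega)]

theorem sum_bits_lt_two_pow {b : ℕ} (x : Fin b → ℕ) (hx : ∀ k, x k = 0 ∨ x k = 1) :
    ∑ k : Fin b, x k * 2 ^ (k : ℕ) < 2 ^ b := by
  induction b with
  | zero => simp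
  | succ b ih =>
    have h := ih (fun k => x k.castSucc) fun k => hx _
    have hl := hx (Fin.last b)
    rw [Fin.sum_univ_castSucc, pow_succ]
    rcases hl with hl | hl <;> simp [hl] at h ⊢ <;> omega

theorem testBit_sum_bits {b : ℕ} (x : Fin b → ℕ) (hx : ∀ k, x k = 0 ∨ x k = 1) (j : Fin b) :
    (∑ k : Fin b, x k * 2 ^ (k : ℕ)).testBit j = decide (x j = 1) := by
  induction b with
  | zero => exact j.elim0
  | succ b ih =>
    have hsum : ∑ k : Fin (b + 1), x k * 2 ^ (k : ℕ) =
        x 0 + 2 * ∑ k : Fin b, x k.succ * 2 ^ (k : ℕ) := by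
      rw [Fin.sum_univ_succ, Finset.mul_sum]
      simp only [Fin.val_zero, pow_zero, mul_one, Fin.val_succ, pow_succ]
      congr 1
      exact Finset.sum_congr rfl fun k _ => by ring
    rw [hsum]
    induction j using Fin.cases with
    | zero =>
      rcases hx 0 with h | h <;> simp [h, Nat.testBit_zero]
    | succ j =>
      rw [Fin.val_succ, Nat.testBit_succ, ← ih (fun k => x k.succ) (fun k => hx _) j]
      congr 1
      have := hx 0
      omega

/-- The disjoint union of stars `K_{1, g + 2}`, one for each `g < N` satisfying `p`, together
with isolated vertices. -/
def starUnion (N : ℕ) (p : ℕ → Prop) : SimpleGraph (Fin N × Option (Fin (N + 2))) where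
  Adj u v := u.1 = v.1 ∧ p u.1 ∧
    ((u.2 = none ∧ ∃ i, v.2 = some i ∧ (i : ℕ) < u.1 + 2) ∨
      (v.2 = none ∧ ∃ i, u.2 = some i ∧ (i : ℕ) < u.1 + 2))
  symm := ⟨by
    rintro ⟨g, s⟩ ⟨g', t⟩ ⟨h, hp, hs⟩
    obtain rfl : g = g' := h
    exact ⟨rfl, hp, hs.symm⟩⟩
  loopless := ⟨by
    rintro ⟨g, s⟩ ⟨-, -, ⟨h, i, h', -⟩ | ⟨h, i, h', -⟩⟩ <;> simp_all⟩

theorem ncard_neighborSet_starUnion_none {N : ℕ} {p : ℕ → Prop} [DecidablePred p] (g : Fin N) :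
    ((starUnion N p).neighborSet (g, none)).ncard = if p g then (g : ℕ) + 2 else 0 := by
  split_ifs with hp
  · have : (starUnion N p).neighborSet (g, none) =
        (fun i : Fin (g + 2) => (g, some (Fin.castLE (by omega) i))) '' Set.univ := by
      ext ⟨g', t⟩
      simp only [SimpleGraph.mem_neighborSet, starUnion, Set.image_univ, Set.mem_range,
        Prod.mk.injEq]
      constructor
      · rintro ⟨rfl, -, ⟨-, i, rfl, hi⟩ | ⟨-, i, h, -⟩⟩
        · exact ⟨⟨i, hi⟩, rfl, rfl⟩
        · simp at h
      · rintro ⟨i, rfl, rfl⟩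
        exact ⟨rfl, hp, .inl ⟨trivial, _, rfl, i.isLt⟩⟩
    rw [this, Set.ncard_image_of_injective, Set.ncard_univ, Nat.card_fin]
    intro i i' h
    simpa using h
  · rw [Set.ncard_eq_zero]
    ext v
    simp [starUnion, hp]

theorem ncard_neighborSet_starUnion_some {N : ℕ} {p : ℕ → Prop} (g : Fin N) (i : Fin (N + 2)) :
    ((starUnion N p).neighborSet (g, some i)).ncard ≤ 1 := by
  rw [← Set.ncard_singleton (g, (none : Option (Fin (N + 2))))]
  refine Set.ncard_le_ncard ?_
  rintro ⟨g', t⟩ ⟨h, -, ⟨h', -⟩ | ⟨h', -⟩⟩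
  · simp at h'
  · simp_all

theorem sum_pwlActivation_starUnion {N : ℕ} (p : ℕ → Prop) [DecidablePred p] {γ : ℕ}
    (hγ : γ < N) :
    ∑ v, pwlActivation ((γ : ℝ) - ((starUnion N p).neighborSet v).ncard) =
      if p γ then 1 else 0 := by
  have hsome (g : Fin N) (i : Fin (N + 2)) :
      ((starUnion N p).neighborSet (g, some i)).ncard ≠ γ + 2 := by
    have := ncard_neighborSet_starUnion_some (p := p) g i
    omega
  simp only [pwlActivation_natCast_sub_natCast, Fintype.sum_prod_type, Fintype.sum_option, hsome,
    if_false, Finset.sum_const_zero, add_zero, ncard_neighborSet_starUnion_none]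
  rw [Finset.sum_eq_single ⟨γ, hγ⟩]
  · by_cases hp : p γ <;> simp [hp]
  · intro g _ hg
    have : (g : ℕ) ≠ γ := fun h => hg (Fin.ext h)
    refine if_neg ?_
    split_ifs <;> simp [this]
  · simp

theorem SimpleGraph.ncard_neighborSet_comap_equiv {V W : Type*} (G : SimpleGraph W) (e : V ≃ W)
    (v : V) : ((G.comap e).neighborSet v).ncard = (G.neighborSet (e v)).ncard := by
  have : (G.comap e).neighborSet v = e ⁻¹' G.neighborSet (e v) := rfl
  rw [this, Set.ncard_preimage_of_injective_subset_range e.injective (by simp)]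

/-- For every b ≥ 1 there are finite simple graphs G_1,…,G_b such
that for every bit string x ∈ {0,1}^b, with γ_x = Σ_{k=1}^b x_k · 2^{k−1}, we
have Σ_{v ∈ V(G_j)} f(γ_x − deg_{G_j}(v)) = x_j for every j ∈ {1,…,b}. -/
theorem exists_graphs_pwl_invariant (b : ℕ) (hb : 0 < b) :
    ∃ (n : Fin b → ℕ) (G : ∀ j, SimpleGraph (Fin (n j))),
      ∀ x : Fin b → ℕ, (∀ k, x k = 0 ∨ x k = 1) →
        ∀ j, ∑ v, pwlActivation
            ((∑ k : Fin b, (x k : ℝ) * 2 ^ (k : ℕ)) - ((G j).neighborSet v).ncard)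
          = (x j : ℝ) := by
  classical
  let e := (Fintype.equivFin (Fin (2 ^ b) × Option (Fin (2 ^ b + 2)))).symm
  refine ⟨fun _ => _, fun j => (starUnion (2 ^ b) fun g => g.testBit j).comap e, fun x hx j => ?_⟩
  have hcast : ∑ k : Fin b, (x k : ℝ) * 2 ^ (k : ℕ) =
      ((∑ k : Fin b, x k * 2 ^ (k : ℕ) : ℕ) : ℝ) := by push_cast; rfl
  simp only [SimpleGraph.ncard_neighborSet_comap_equiv, hcast]
  rw [e.sum_comp fun v => pwlActivation (_ - ((starUnion (2 ^ b) _).neighborSet v).ncard),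
    sum_pwlActivation_starUnion _ (sum_bits_lt_two_pow x hx), testBit_sum_bits x hx]
  rcases hx j with h | h <;> simp [h]
end

section
/- Let f : ℝ → ℝ be defined by f(x) = 0 if x ≤ −3; f(x) = x + 3 if −3 < x ≤ −2; f(x) = −x − 1 if −2 < x < −1; and f(x) = 0 if x ≥ −1. For every natural number m, there exist finite simple graphs G_1, ..., G_m such that for every subset S ⊆ {1, ..., m} there exists a natural number γ with: for every j ∈ {1, ..., m}, Σ_{v ∈ V(G_j)} f(γ − deg_{G_j}(v)) ≥ 1 if and only if j ∈ S. In other words, the class of graph classifiers of the form G ↦ [Σ_{v ∈ V(G)} f(γ − deg_G(v)) ≥ 1], γ ∈ ℕ, shatters arbitrarily large finite sets of graphs, i.e., has infinite VC dimension over the class of all finite simple graphs. -/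
/-- On integers, `pwlActivation` is the indicator function of `-2`. -/
lemma pwlActivation_natCast_sub (a b : ℕ) :
    pwlActivation ((a : ℝ) - b) = if b = a + 2 then 1 else 0 := by
  unfold pwlActivation
  rcases lt_trichotomy b (a + 2) with h | h | h
  · have h' : (b : ℝ) ≤ a + 1 := by exact_mod_cast Nat.lt_succ_iff.mp h
    rw [if_neg (by linarith), if_neg (by linarith), if_neg (by linarith), if_neg h.ne]
  · subst h
    push_cast
    rw [if_neg (by linarith), if_pos (by linarith), if_pos rfl]
    ring
  · have h' : (a : ℝ) + 3 ≤ b := by exact_mod_cast h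
    rw [if_pos (by linarith), if_neg h.ne']

lemma one_le_sum_pwlActivation_iff {ι : Type*} [Fintype ι] (a : ℕ) (d : ι → ℕ) :
    1 ≤ ∑ v, pwlActivation ((a : ℝ) - d v) ↔ ∃ v, d v = a + 2 := by
  simp only [pwlActivation_natCast_sub, Finset.sum_boole]
  rw [Nat.one_le_cast, Nat.one_le_iff_ne_zero, Finset.card_ne_zero]
  simp [Finset.filter_nonempty_iff]

/-- Every finite set of natural numbers is the set of degrees of a finite simple graph. -/
lemma SimpleGraph.exists_degree_set_eq (D : Finset ℕ) :
    ∃ (n : ℕ) (G : SimpleGraph (Fin n)), ∀ d, (∃ v, (G.neighborSet v).ncard = d) ↔ d ∈ D := by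
  let e := Fintype.equivFin (Σ d : D, Fin (d + 1))
  let G : SimpleGraph (Fin (Fintype.card (Σ d : D, Fin (d + 1)))) :=
    { Adj := fun a b => a ≠ b ∧ (e.symm b).1 = (e.symm a).1
      symm := ⟨fun _ _ h => ⟨h.1.symm, h.2.symm⟩⟩
      loopless := ⟨fun _ h => h.1 rfl⟩ }
  have degree_eq (a) : (G.neighborSet a).ncard = (e.symm a).1 := by
    have fiber : {b | (e.symm b).1 = (e.symm a).1} =
        Set.range (e ∘ Sigma.mk (e.symm a).1) := by
      ext b
      constructor
      · intro h
        obtain ⟨⟨d, i⟩, rfl⟩ := e.surjective b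
        simp only [Set.mem_ofPred_eq, Equiv.symm_apply_apply] at h
        subst h
        exact ⟨i, rfl⟩
      · rintro ⟨i, rfl⟩
        simp
    have nbhd : G.neighborSet a = {b | (e.symm b).1 = (e.symm a).1} \ {a} := by
      ext b
      simp [G, and_comm, eq_comm]
    rw [nbhd, Set.ncard_sdiff_singleton_of_mem (by simp), fiber, ← Set.image_univ,
      Set.ncard_image_of_injective _ (e.injective.comp sigma_mk_injective)]
    simp
  refine ⟨_, G, fun d => ⟨?_, fun hd => ⟨e ⟨⟨d, hd⟩, 0⟩, ?_⟩⟩⟩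
  · rintro ⟨v, rfl⟩
    rw [degree_eq]
    exact (e.symm v).1.2
  · rw [degree_eq, Equiv.symm_apply_apply]

/-- For every m there exist finite simple graphs G_1,…,G_m such
that for every subset S ⊆ {1,…,m} there exists γ ∈ ℕ with: for every j,
Σ_{v ∈ V(G_j)} f(γ − deg_{G_j}(v)) ≥ 1 iff j ∈ S. That is, the class of graph
classifiers G ↦ [Σ_{v ∈ V(G)} f(γ − deg_G(v)) ≥ 1], γ ∈ ℕ, shatters arbitrarily
large finite sets of graphs. -/
theorem pwl_classifiers_shatter (m : ℕ) :
    ∃ (n : Fin m → ℕ) (G : ∀ j, SimpleGraph (Fin (n j))),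
      ∀ S : Set (Fin m), ∃ γ : ℕ,
        ∀ j, (1 ≤ ∑ v, pwlActivation ((γ : ℝ) - ((G j).neighborSet v).ncard))
          ↔ j ∈ S := by
  classical
  let code := Fintype.equivFin (Set (Fin m))
  choose n G hG using fun j : Fin m => SimpleGraph.exists_degree_set_eq
    ((Finset.univ.filter fun S : Set (Fin m) => j ∈ S).image fun S => (code S : ℕ) + 2)
  refine ⟨n, G, fun S => ⟨code S, fun j => ?_⟩⟩
  rw [one_le_sum_pwlActivation_iff, hG]
  simp [Fin.val_inj]
end

section
/- For all natural numbers b ≥ 1 and j with 1 ≤ j ≤ b, there exists a finite simple graph G on 4^{b+1} + 2 vertices having exactly one vertex of degree 4^j − 1, while every other vertex of G has degree 4^{b+1} − 1. -/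
/-- The successor map on `{0, …, N - 1}` that fixes `0`, swaps `2 * i + 1` and `2 * i + 2` for
`i < k`, and rotates `{2 * k + 1, …, N - 1}` cyclically. -/
def windmillSucc (N k v : ℕ) : ℕ :=
  if v ≤ 2 * k then (if v % 2 = 1 then v + 1 else v - 1)
  else if v + 1 = N then 2 * k + 1 else v + 1

/-- The complement of the disjoint union of a windmill of `k` triangles through `0`
and a cycle on `{2 * k + 1, …, N - 1}`. -/
def windmillCompl (N k : ℕ) : SimpleGraph (Fin N) where
  Adj u v := u ≠ v ∧ v.val ≠ windmillSucc N k u ∧ u.val ≠ windmillSucc N k v ∧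
    ¬(u.val = 0 ∧ v.val ≤ 2 * k) ∧ ¬(v.val = 0 ∧ u.val ≤ 2 * k)
  symm := ⟨fun _ _ ⟨h₁, h₂, h₃, h₄, h₅⟩ => ⟨h₁.symm, h₃, h₂, h₅, h₄⟩⟩
  loopless := ⟨fun _ h => h.1 rfl⟩

lemma windmillCompl_ncard_neighborSet_zero {N k : ℕ} (h : 2 * k + 4 ≤ N) :
    ((windmillCompl N k).neighborSet ⟨0, by omega⟩).ncard = N - (2 * k + 1) := by
  have : (windmillCompl N k).neighborSet ⟨0, by omega⟩ =
      ↑(Finset.Ioi (⟨2 * k, by omega⟩ : Fin N)) := by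
    ext ⟨v, hv⟩
    simp only [SimpleGraph.mem_neighborSet, windmillCompl, Finset.coe_Ioi, Set.mem_Ioi,
      Fin.lt_def, ne_eq, Fin.mk.injEq]
    grind [windmillSucc]
  rw [this, Set.ncard_coe_finset, Fin.card_Ioi]
  simp only
  omega

lemma ncard_compl_triple {N : ℕ} {v a c : Fin N} (hva : v ≠ a) (hvc : v ≠ c) (hac : a ≠ c) :
    (({v, a, c} : Set (Fin N))ᶜ).ncard = N - 3 := by
  rw [Set.ncard_compl, Nat.card_fin, Set.ncard_eq_three.2 ⟨v, a, c, hva, hvc, hac, rfl⟩]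

lemma windmillCompl_ncard_neighborSet {N k : ℕ} (h : 2 * k + 4 ≤ N) {v : Fin N}
    (hv : v.val ≠ 0) : ((windmillCompl N k).neighborSet v).ncard = N - 3 := by
  obtain ⟨v, hvN⟩ := v
  obtain ⟨a, c, ha, hc, hva, hvc, hac, H⟩ : ∃ a c, a < N ∧ c < N ∧ v ≠ a ∧ v ≠ c ∧ a ≠ c ∧
      ∀ w < N, (v ≠ w ∧ w ≠ windmillSucc N k v ∧ v ≠ windmillSucc N k w ∧
        ¬(v = 0 ∧ w ≤ 2 * k) ∧ ¬(w = 0 ∧ v ≤ 2 * k)) ↔ ¬(w = v ∨ w = a ∨ w = c) := by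
    simp only at hv
    refine ⟨windmillSucc N k v, if v ≤ 2 * k then 0 else if v = 2 * k + 1 then N - 1 else v - 1,
      ?_, ?_, ?_, ?_, ?_, fun w hw => ?_⟩ <;> grind [windmillSucc]
  rw [← ncard_compl_triple (v := ⟨v, hvN⟩) (a := ⟨a, ha⟩) (c := ⟨c, hc⟩) (by simpa using hva)
    (by simpa using hvc) (by simpa using hac)]
  congr 1
  ext ⟨w, hw⟩
  simpa [windmillCompl] using H w hw

/-- For b ≥ 1 and 1 ≤ j ≤ b, there exists a finite simple graph on
4^{b+1} + 2 vertices with exactly one vertex of degree 4^j − 1, all other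
vertices having degree 4^{b+1} − 1. -/
theorem exists_gadget_graph (b j : ℕ) (hb : 1 ≤ b) (hj1 : 1 ≤ j) (hjb : j ≤ b) :
    ∃ (G : SimpleGraph (Fin (4 ^ (b + 1) + 2))) (r : Fin (4 ^ (b + 1) + 2)),
      (G.neighborSet r).ncard = 4 ^ j - 1 ∧
      ∀ v, v ≠ r → (G.neighborSet v).ncard = 4 ^ (b + 1) - 1 := by
  have hle : 4 ^ j ≤ 4 ^ (b + 1) := Nat.pow_le_pow_right (by norm_num) (by omega)
  have hj : 4 ∣ 4 ^ j := dvd_pow_self 4 (by omega)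
  have hpos : 0 < 4 ^ j := by positivity
  have hb' : 4 ∣ 4 ^ (b + 1) := dvd_pow_self 4 (by omega)
  generalize 4 ^ (b + 1) = M at *
  generalize 4 ^ j = m at *
  have hN : 2 * ((M - m + 2) / 2) + 4 ≤ M + 2 := by omega
  refine ⟨windmillCompl (M + 2) ((M - m + 2) / 2), ⟨0, by omega⟩, ?_, fun v hv => ?_⟩
  · rw [windmillCompl_ncard_neighborSet_zero hN]
    omega
  · rw [windmillCompl_ncard_neighborSet hN fun h => hv (Fin.ext h)]
    omega
end

section
/- For every positive natural number b, there exist finite simple graphs G_1, ..., G_b such that for every bit string x = (x_1, ..., x_b) ∈ {0,1}^b, setting γ_x = Σ_{k=1}^{b} x_k / 4^k, it holds for every j ∈ {1, ..., b} that Σ_{v ∈ V(G_j)} sin((π/2)·(1 + deg_{G_j}(v))·γ_x) ≥ 2/3 if and only if x_j = 1. -/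
/-- The complete multipartite graph with `p` parts of size three and `k` parts of size two,
together with an apex vertex joined to the vertices of the parts of size three. -/
def apexMultipartite (p k : ℕ) : SimpleGraph (Option (Fin p × Fin 3 ⊕ Fin k × Fin 2)) where
  Adj u v := match u, v with
    | none, some (.inl _) => True
    | some (.inl _), none => True
    | some (.inl a), some (.inl b) => a.1 ≠ b.1
    | some (.inl _), some (.inr _) => True
    | some (.inr _), some (.inl _) => True
    | some (.inr a), some (.inr b) => a.1 ≠ b.1
    | _, _ => False
  symm := ⟨by
    rintro (_ | _ | _) (_ | _ | _) h
    all_goals first | exact h | exact Ne.symm h⟩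
  loopless := ⟨by
    rintro (_ | _ | _) h
    · exact h
    · exact h rfl
    · exact h rfl⟩

open Classical in
theorem SimpleGraph.ncard_neighborSet_eq_sum {V : Type*} [Fintype V] (G : SimpleGraph V) (v : V) :
    (G.neighborSet v).ncard = ∑ w, if G.Adj v w then 1 else 0 := by
  rw [Finset.sum_boole, Set.ncard_eq_toFinset_card']
  simp only [Nat.cast_id]
  congr 1
  ext w
  simp

theorem ncard_neighborSet_apexMultipartite_none (p k : ℕ) :
    ((apexMultipartite p k).neighborSet none).ncard = 3 * p := by
  classical
  rw [SimpleGraph.ncard_neighborSet_eq_sum, Fintype.sum_option, Fintype.sum_sum_type]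
  simp [apexMultipartite, mul_comm]

theorem sum_prod_fin_ite_ne (p q : ℕ) (i : Fin p) [∀ w : Fin p × Fin q, Decidable (i ≠ w.1)] :
    (∑ w : Fin p × Fin q, if i ≠ w.1 then 1 else 0) = q * (p - 1) := by
  have h : (Finset.univ.filter fun w : Fin p × Fin q => i ≠ w.1) = {i}ᶜ ×ˢ Finset.univ := by
    ext w
    simp [eq_comm]
  rw [Finset.sum_boole, h, Finset.card_product, Finset.card_compl]
  simp [mul_comm]

theorem ncard_neighborSet_apexMultipartite_some (p k : ℕ) (v : Fin p × Fin 3 ⊕ Fin k × Fin 2) :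
    ((apexMultipartite p k).neighborSet (some v)).ncard + 2 = 3 * p + 2 * k := by
  classical
  rw [SimpleGraph.ncard_neighborSet_eq_sum, Fintype.sum_option, Fintype.sum_sum_type]
  rcases v with v | v
  · have h₀ : (apexMultipartite p k).Adj (some (.inl v)) none ↔ True := Iff.rfl
    have h₁ (w) : (apexMultipartite p k).Adj (some (.inl v)) (some (.inl w)) ↔ v.1 ≠ w.1 := Iff.rfl
    have h₂ (w) : (apexMultipartite p k).Adj (some (.inl v)) (some (.inr w)) ↔ True := Iff.rfl
    simp only [h₀, h₁, h₂, sum_prod_fin_ite_ne, if_true, Finset.sum_const, Finset.card_univ,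
      Fintype.card_prod, Fintype.card_fin, smul_eq_mul]
    have := v.1.pos
    omega
  · have h₀ : (apexMultipartite p k).Adj (some (.inr v)) none ↔ False := Iff.rfl
    have h₁ (w) : (apexMultipartite p k).Adj (some (.inr v)) (some (.inl w)) ↔ True := Iff.rfl
    have h₂ (w) : (apexMultipartite p k).Adj (some (.inr v)) (some (.inr w)) ↔ v.1 ≠ w.1 := Iff.rfl
    simp only [h₀, h₁, h₂, sum_prod_fin_ite_ne, if_true, if_false, Finset.sum_const,
      Finset.card_univ, Fintype.card_prod, Fintype.card_fin, smul_eq_mul]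
    have := v.1.pos
    omega

theorem sum_digits_div_four_pow_mem_Icc (y : ℕ → ℕ) (hy : ∀ k, y k ≤ 1) (n : ℕ) :
    ∑ k ∈ Finset.range n, (y k : ℝ) / 4 ^ (k + 1) ∈ Set.Icc (0 : ℝ) (1 / 3) := by
  refine ⟨Finset.sum_nonneg fun k _ => by positivity, ?_⟩
  suffices h : ∑ k ∈ Finset.range n, (y k : ℝ) / 4 ^ (k + 1) ≤ 1 / 3 - 1 / 3 / 4 ^ n by
    have : (0 : ℝ) ≤ 1 / 3 / 4 ^ n := by positivity
    linarith
  induction n with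
  | zero => simp
  | succ n ih =>
    rw [Finset.sum_range_succ]
    have h1 : (y n : ℝ) / 4 ^ (n + 1) ≤ 1 / 4 ^ (n + 1) := by
      gcongr
      exact_mod_cast hy n
    have h2 : (1 : ℝ) / 3 / 4 ^ n = 1 / 3 / 4 ^ (n + 1) + 1 / 4 ^ (n + 1) := by
      rw [pow_succ]
      field_simp
      norm_num
    linarith

theorem exists_nat_four_pow_mul_sum_digits (y : ℕ → ℕ) (n : ℕ) :
    ∃ A : ℕ, 4 ^ n * ∑ k ∈ Finset.range n, (y k : ℝ) / 4 ^ (k + 1) = A := by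
  induction n with
  | zero => exact ⟨0, by simp⟩
  | succ n ih =>
    obtain ⟨A, hA⟩ := ih
    refine ⟨4 * A + y n, ?_⟩
    rw [Finset.sum_range_succ, mul_add, pow_succ', mul_assoc, hA]
    push_cast
    field_simp

theorem exists_four_pow_mul_sum_digits_eq (y : ℕ → ℕ) (hy : ∀ k, y k ≤ 1) {j n : ℕ} (hj : j < n) :
    ∃ (A : ℕ) (t : ℝ), t ∈ Set.Icc (0 : ℝ) (1 / 3) ∧
      4 ^ (j + 1) * ∑ k ∈ Finset.range n, (y k : ℝ) / 4 ^ (k + 1) = 4 * A + y j + t := by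
  obtain ⟨A, hA⟩ := exists_nat_four_pow_mul_sum_digits y j
  obtain ⟨m, rfl⟩ := Nat.exists_eq_add_of_le (Nat.succ_le_of_lt hj)
  refine ⟨A, _, sum_digits_div_four_pow_mem_Icc (fun k => y (j + 1 + k)) (fun k => hy _) m, ?_⟩
  rw [Nat.succ_eq_add_one, Finset.sum_range_add, Finset.sum_range_succ, mul_add, mul_add, ← hA]
  congr 1
  · rw [pow_succ' 4 j, mul_assoc]
    congr 1
    field_simp
  · rw [Finset.mul_sum]
    refine Finset.sum_congr rfl fun k _ => ?_
    rw [add_assoc (j + 1) k 1, pow_add _ (j + 1) (k + 1)]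
    field_simp

theorem two_thirds_le_sin_iff (A d : ℕ) (hd : d = 0 ∨ d = 1) (t : ℝ)
    (ht : t ∈ Set.Icc (0 : ℝ) (1 / 3)) :
    2 / 3 ≤ Real.sin (Real.pi / 2 * (4 * A + d + t)) ↔ d = 1 := by
  obtain ⟨ht0, ht1⟩ := ht
  have hpi := Real.pi_pos
  have hper : Real.sin (Real.pi / 2 * (4 * A + d + t)) = Real.sin (Real.pi / 2 * (d + t)) := by
    rw [← Real.sin_add_nat_mul_two_pi (Real.pi / 2 * (d + t)) A]
    ring_nf
  rw [hper]
  rcases hd with rfl | rfl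
  · have h : Real.sin (Real.pi / 2 * t) ≤ Real.sin (Real.pi / 6) :=
      Real.sin_le_sin_of_le_of_le_pi_div_two (by nlinarith) (by linarith) (by nlinarith)
    rw [Real.sin_pi_div_six] at h
    simp only [Nat.cast_zero, zero_add, zero_ne_one, iff_false, not_le]
    linarith
  · have h : Real.cos (Real.pi / 6) ≤ Real.cos (Real.pi / 2 * t) :=
      Real.cos_le_cos_of_nonneg_of_le_pi (by positivity) (by linarith) (by nlinarith)
    rw [Real.cos_pi_div_six] at h
    have h3 : (4 / 3 : ℝ) ≤ √3 := Real.le_sqrt_of_sq_le (by norm_num)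
    have he : Real.sin (Real.pi / 2 * ((1 : ℕ) + t)) = Real.cos (Real.pi / 2 * t) := by
      rw [← Real.sin_add_pi_div_two]
      push_cast
      ring_nf
    rw [he]
    simp only [iff_true]
    linarith

theorem exists_graph_degree_four_pow (b j : ℕ) (hj : j < b) :
    ∃ p k : ℕ, 3 * p + 1 = 4 ^ (j + 1) ∧ 3 * p + 2 * k = 2 * 4 ^ b + 1 := by
  have h1 : 4 ^ (j + 1) % 3 = 1 := by
    rw [Nat.pow_mod]
    simp
  have h2 : 4 ^ (j + 1) ≤ 4 ^ b := Nat.pow_le_pow_right (by norm_num) hj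
  have h3 : 4 ^ (j + 1) = 4 * 4 ^ j := pow_succ' 4 j
  exact ⟨4 ^ (j + 1) / 3, (2 * 4 ^ b + 2 - 4 ^ (j + 1)) / 2, by omega, by omega⟩

theorem sum_sin_apexMultipartite {b p k m : ℕ} (γ : ℝ) (hp : 3 * p + 1 = m)
    (hk : 3 * p + 2 * k = 2 * 4 ^ b + 1) (hγ : ∃ A : ℕ, 4 ^ b * γ = A) :
    ∑ v, Real.sin (Real.pi / 2 * (1 + (((apexMultipartite p k).neighborSet v).ncard : ℝ)) * γ)
      = Real.sin (Real.pi / 2 * (m * γ)) := by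
  obtain ⟨A, hA⟩ := hγ
  rw [Fintype.sum_option, Finset.sum_eq_zero, add_zero,
    ncard_neighborSet_apexMultipartite_none, ← hp]
  · push_cast
    ring_nf
  · intro v _
    have h : 1 + ((apexMultipartite p k).neighborSet (some v)).ncard = 2 * 4 ^ b := by
      have := ncard_neighborSet_apexMultipartite_some p k v
      omega
    have h' : (1 : ℝ) + ((apexMultipartite p k).neighborSet (some v)).ncard = 2 * 4 ^ b := by
      exact_mod_cast h
    rw [h', ← Real.sin_nat_mul_pi A, ← hA]
    ring_nf

theorem SimpleGraph.exists_fin_sum_comp_ncard_neighborSet {V : Type*} [Fintype V]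
    (G : SimpleGraph V) :
    ∃ (n : ℕ) (H : SimpleGraph (Fin n)), ∀ f : ℕ → ℝ,
      ∑ v, f (H.neighborSet v).ncard = ∑ v, f (G.neighborSet v).ncard := by
  let e := Fintype.equivFin V
  refine ⟨Fintype.card V, G.comap e.symm, fun f => ?_⟩
  rw [← e.symm.sum_comp]
  refine Finset.sum_congr rfl fun v _ => ?_
  congr 1
  rw [← Set.ncard_image_of_injective _ e.symm.injective]
  congr 1
  ext w
  simp

/-- For every b ≥ 1 there exist finite simple graphs G_1,…,G_b
such that for every bit string x ∈ {0,1}^b, with γ_x = Σ_{k=1}^b x_k / 4^k,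
it holds for every j that
Σ_{v ∈ V(G_j)} sin((π/2)·(1 + deg_{G_j}(v))·γ_x) ≥ 2/3 iff x_j = 1. -/
theorem exists_graphs_sin_invariant (b : ℕ) (hb : 0 < b) :
    ∃ (n : Fin b → ℕ) (G : ∀ j, SimpleGraph (Fin (n j))),
      ∀ x : Fin b → ℕ, (∀ k, x k = 0 ∨ x k = 1) →
        ∀ j, (2 / 3 ≤ ∑ v, Real.sin (Real.pi / 2
              * (1 + (((G j).neighborSet v).ncard : ℝ))
              * (∑ k : Fin b, (x k : ℝ) / 4 ^ ((k : ℕ) + 1))))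
          ↔ x j = 1 := by
  choose p k hp hk using fun j : Fin b => exists_graph_degree_four_pow b j j.isLt
  choose n G hG using fun j : Fin b =>
    (apexMultipartite (p j) (k j)).exists_fin_sum_comp_ncard_neighborSet
  refine ⟨n, G, fun x hx j => ?_⟩
  let y : ℕ → ℕ := fun i => if h : i < b then x ⟨i, h⟩ else 0
  have hyx : ∀ i : Fin b, y i = x i := fun i => by simp [y]
  have hy : ∀ i, y i ≤ 1 := by
    intro i
    by_cases h : i < b
    · have := hx ⟨i, h⟩
      simp only [y, h, dite_true]
      omega
    · simp [y, h]
  have hsum : ∑ i : Fin b, (x i : ℝ) / 4 ^ ((i : ℕ) + 1)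
      = ∑ i ∈ Finset.range b, (y i : ℝ) / 4 ^ (i + 1) := by
    rw [Finset.sum_range]
    simp only [hyx]
  rw [hsum, hG j fun d => Real.sin (Real.pi / 2 * (1 + (d : ℝ)) *
      ∑ i ∈ Finset.range b, (y i : ℝ) / 4 ^ (i + 1)),
    sum_sin_apexMultipartite _ (hp j) (hk j) (exists_nat_four_pow_mul_sum_digits y b)]
  obtain ⟨A, t, ht, h⟩ := exists_four_pow_mul_sum_digits_eq y hy j.isLt
  rw [Nat.cast_pow, Nat.cast_ofNat, h, hyx]
  exact two_thirds_le_sin_iff A (x j) (hx j) t ht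
end

section
/- For every natural number m, there exist finite simple graphs G_1, ..., G_m such that for every subset S ⊆ {1, ..., m} there exists a real number γ with: for every j ∈ {1, ..., m}, Σ_{v ∈ V(G_j)} sin((π/2)·(1 + deg_{G_j}(v))·γ) ≥ 2/3 if and only if j ∈ S. In other words, the class of graph classifiers of the form G ↦ [Σ_{v ∈ V(G)} sin((π/2)(1 + deg_G(v))γ) ≥ 2/3], parameterized by a single real parameter γ, shatters arbitrarily large finite sets of graphs, i.e., has infinite VC dimension over the class of all finite simple graphs. -/
theorem two_thirds_le_sin {x : ℝ} (h₁ : Real.pi / 4 ≤ x) (h₂ : x ≤ Real.pi / 2) :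
    2 / 3 ≤ Real.sin x := by
  have h : Real.sin (Real.pi / 4) ≤ Real.sin x :=
    Real.sin_le_sin_of_le_of_le_pi_div_two (by linarith [Real.pi_pos]) h₂ h₁
  have h_sqrt : (4 / 3 : ℝ) ≤ √2 := Real.le_sqrt_of_sq_le (by norm_num)
  rw [Real.sin_pi_div_four] at h
  linarith

/-- The sign pattern of `sin (2 * π * 8 ^ j * θ)` for `j < m` can be prescribed by choosing the
base-8 digits of `θ`: the digit `1` gives a value at least `2 / 3`, the digit `4` a nonpositive
value. -/
theorem exists_sin_two_pi_mul_eight_pow_pattern (m : ℕ) (b : ℕ → Prop) :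
    ∃ θ : ℝ, 0 ≤ θ ∧ θ ≤ 1 ∧ ∀ j < m,
      (b j → 2 / 3 ≤ Real.sin (2 * Real.pi * 8 ^ j * θ)) ∧
      (¬ b j → Real.sin (2 * Real.pi * 8 ^ j * θ) ≤ 0) := by
  induction m generalizing b with
  | zero => exact ⟨0, le_rfl, zero_le_one, by simp⟩
  | succ m ih =>
    obtain ⟨θ, h₀, h₁, hθ⟩ := ih fun j => b (j + 1)
    have hpi := Real.pi_pos
    have hmul₀ : 0 ≤ Real.pi * θ := by positivity
    have hmul₁ : Real.pi * θ ≤ Real.pi := mul_le_of_le_one_right hpi.le h₁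
    have h_shift (d j : ℕ) : Real.sin (2 * Real.pi * 8 ^ (j + 1) * ((d + θ) / 8)) =
        Real.sin (2 * Real.pi * 8 ^ j * θ) := by
      rw [← Real.sin_add_nat_mul_two_pi (2 * Real.pi * 8 ^ j * θ) (8 ^ j * d)]
      congr 1
      push_cast
      ring
    by_cases hb : b 0
    · refine ⟨((1 : ℕ) + θ) / 8, by positivity, by norm_num; linarith, ?_⟩
      rintro (_ | j) hj
      · refine ⟨fun _ => two_thirds_le_sin ?_ ?_, fun h => absurd hb h⟩ <;>
          norm_num <;> linarith
      · simpa only [h_shift] using hθ j (by lia)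
    · refine ⟨((4 : ℕ) + θ) / 8, by positivity, by norm_num; linarith, ?_⟩
      rintro (_ | j) hj
      · refine ⟨fun h => absurd h hb, fun _ => ?_⟩
        rw [← neg_nonneg, ← Real.sin_sub_pi]
        apply Real.sin_nonneg_of_nonneg_of_le_pi <;> norm_num <;> linarith
      · simpa only [h_shift] using hθ j (by lia)


/-- For every m there exist finite simple graphs G_1,…,G_m such
that for every subset S ⊆ {1,…,m} there exists a real number γ with: for every
j, Σ_{v ∈ V(G_j)} sin((π/2)·(1 + deg_{G_j}(v))·γ) ≥ 2/3 iff j ∈ S. That is, the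
class of graph classifiers G ↦ [Σ_{v ∈ V(G)} sin((π/2)(1 + deg_G(v))γ) ≥ 2/3],
parameterized by a single real parameter γ, shatters arbitrarily large finite
sets of graphs. -/
theorem sin_classifiers_shatter (m : ℕ) :
    ∃ (n : Fin m → ℕ) (G : ∀ j, SimpleGraph (Fin (n j))),
      ∀ S : Set (Fin m), ∃ γ : ℝ,
        ∀ j, (2 / 3 ≤ ∑ v, Real.sin (Real.pi / 2
              * (1 + (((G j).neighborSet v).ncard : ℝ)) * γ))
          ↔ j ∈ S := by
  refine ⟨fun j => 8 ^ (j : ℕ), fun _ => ⊤, fun S => ?_⟩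
  obtain ⟨θ, -, -, hθ⟩ :=
    exists_sin_two_pi_mul_eight_pow_pattern m fun i => ∃ h : i < m, (⟨i, h⟩ : Fin m) ∈ S
  refine ⟨4 * θ, fun j => ?_⟩
  have h_sum : ∑ v : Fin (8 ^ (j : ℕ)), Real.sin (Real.pi / 2 *
      (1 + (((⊤ : SimpleGraph (Fin (8 ^ (j : ℕ)))).neighborSet v).ncard : ℝ)) * (4 * θ)) =
      8 ^ (j : ℕ) * Real.sin (2 * Real.pi * 8 ^ (j : ℕ) * θ) := by
    have h_deg (v : Fin (8 ^ (j : ℕ))) :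
        (1 + (((⊤ : SimpleGraph (Fin (8 ^ (j : ℕ)))).neighborSet v).ncard : ℝ)) =
          8 ^ (j : ℕ) := by
      rw [← Nat.card_coe_set_eq, Nat.card_eq_fintype_card, SimpleGraph.card_neighborSet_eq_degree,
        SimpleGraph.complete_graph_degree, Fintype.card_fin, Nat.cast_sub (Nat.one_le_pow _ _ (by norm_num))]
      push_cast
      ring
    simp only [h_deg, Finset.sum_const, Finset.card_univ, Fintype.card_fin, nsmul_eq_mul]
    push_cast
    ring_nf
  have h_pow : (1 : ℝ) ≤ 8 ^ (j : ℕ) := one_le_pow₀ (by norm_num)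
  obtain ⟨h_mem, h_notMem⟩ := hθ j j.isLt
  rw [h_sum]
  constructor
  · intro h
    by_contra hj
    have := h_notMem fun ⟨_, h'⟩ => hj h'
    nlinarith
  · intro hj
    have := h_mem ⟨j.isLt, hj⟩
    nlinarith
end
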